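/- Let p ≥ 2 and let γ_1, γ_2, …, γ_p : [0,∞) → [0,∞) be functions of class N. If (γ_1∘γ_2∘⋯∘γ_p)(s) < s for all s > 0, then for every k ∈ {1,…,p} the cyclically permuted composition satisfies (γ_k∘γ_{k+1}∘⋯∘γ_p∘γ_1∘⋯∘γ_{k−1})(s) < s for all s > 0. -/

import Mathlib

/-- A function `γ : [0,∞) → [0,∞)` of class N: continuous, non-decreasing, `γ(0)=0`. -/
def ClassN (γ : ℝ → ℝ) : Prop :=
  ContinuousOn γ (Set.Ici 0) ∧ MonotoneOn γ (Set.Ici 0) ∧ γ 0 = 0 ∧ ∀ s, 0 ≤ s → 0 ≤ γ s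

theorem List.foldr_comp_eq {α : Type*} (l : List (α → α)) (g : α → α) :
    l.foldr (· ∘ ·) g = l.foldr (· ∘ ·) id ∘ g := by
  induction l with
  | nil => rfl
  | cons f l ih => rw [List.foldr_cons, ih, List.foldr_cons, Function.comp_assoc]

theorem List.ofFn_add_eq_rotate {α : Type*} {p : ℕ} (f : Fin p → α) (k : Fin p) :
    List.ofFn (fun j => f (k + j)) = (List.ofFn f).rotate k := by
  refine List.ext_getElem (by simp) fun i h₁ h₂ => ?_
  rw [List.getElem_rotate]
  simp only [List.getElem_ofFn, List.length_ofFn]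
  congr 1
  ext
  simp [Fin.val_add, Nat.add_comm]

theorem ClassN.id : ClassN id :=
  ⟨continuousOn_id, monotoneOn_id, rfl, fun _ hs => hs⟩

theorem ClassN.comp {f g : ℝ → ℝ} (hf : ClassN f) (hg : ClassN g) : ClassN (f ∘ g) := by
  obtain ⟨hfc, hfm, hf0, hfn⟩ := hf
  obtain ⟨hgc, hgm, hg0, hgn⟩ := hg
  exact ⟨hfc.comp hgc hgn, hfm.comp hgm hgn, by simp [hg0, hf0], fun s hs => hfn _ (hgn s hs)⟩

theorem ClassN.foldr_comp {l : List (ℝ → ℝ)} (hl : ∀ f ∈ l, ClassN f) :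
    ClassN (l.foldr (· ∘ ·) _root_.id) := by
  induction l with
  | nil => exact ClassN.id
  | cons f l ih =>
    exact (hl f (by simp)).comp (ih fun g hg => hl g (by simp [hg]))

/-- If `f ∘ g` is a strict contraction on `(0,∞)`, then so is `g ∘ f`. -/
theorem ClassN.comp_lt_swap {f g : ℝ → ℝ} (hf : ClassN f) (hg : ClassN g)
    (h : ∀ s, 0 < s → f (g s) < s) {s : ℝ} (hs : 0 < s) : g (f s) < s := by
  obtain ⟨-, hfm, -, hfn⟩ := hf
  obtain ⟨-, -, hg0, -⟩ := hg
  by_contra! hle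
  rcases (hfn s hs.le).eq_or_lt with h0 | hpos
  · rw [← h0, hg0] at hle
    exact hle.not_gt hs
  · exact (h (f s) hpos).not_ge (hfm hs.le (hs.le.trans hle) hle)

/-- If the composition `γ_1 ∘ γ_2 ∘ ⋯ ∘ γ_p` of class N functions is a strict contraction
on `(0,∞)`, then so is every cyclic permutation
`γ_k ∘ γ_{k+1} ∘ ⋯ ∘ γ_p ∘ γ_1 ∘ ⋯ ∘ γ_{k-1}` of it. -/
theorem cyclic_permutation_contraction (p : ℕ) (hp : 2 ≤ p)
    (γ : Fin p → ℝ → ℝ) (hγ : ∀ j, ClassN (γ j))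
    (h : ∀ s : ℝ, 0 < s → ((List.ofFn fun j : Fin p => γ j).foldr (· ∘ ·) id) s < s) :
    ∀ k : Fin p, ∀ s : ℝ, 0 < s →
      ((List.ofFn fun j : Fin p => γ (k + j)).foldr (· ∘ ·) id) s < s := by
  intro k s hs
  rw [List.ofFn_add_eq_rotate, List.rotate_eq_drop_append_take (by simp), List.foldr_append,
    List.foldr_comp_eq]
  have hmem : ∀ f ∈ List.ofFn γ, ClassN f := by
    intro f hf
    obtain ⟨j, rfl⟩ := List.mem_ofFn.1 hf
    exact hγ j
  refine ClassN.comp_lt_swap (ClassN.foldr_comp fun f hf => hmem f (List.mem_of_mem_take hf))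
    (ClassN.foldr_comp fun f hf => hmem f (List.mem_of_mem_drop hf)) (fun t ht => ?_) hs
  have hlt := h t ht
  rwa [← List.take_append_drop k.val (List.ofFn fun j => γ j), List.foldr_append,
    List.foldr_comp_eq] at hlt
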